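/- arXiv:1108.2283 — 10 statements merged into one kernel-verified Lean document; each statement's English description precedes it below -/
import Mathlib

section
/- D-triangle rule: Let V be a finite set of variables and let I be a ternary relation on pairwise disjoint subsets of V satisfying the Pearl–Paz axioms. Then for all single variables X, Y, W ∈ V (pairwise distinct) and all subsets Z₁, Z₂ ⊆ V with {X,Y,W} ∩ Z₁ = {X,Y,W} ∩ Z₂ = ∅: if ¬I({X},{W},Z₁) and ¬I({W},{Y},Z₂), then ¬I({X},{Y},Z₁ ∩ Z₂). -/
/-- The Pearl–Paz axioms for a ternary independence relation `I` on
pairwise disjoint subsets of a finite set of variables `V`. -/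
structure PearlPaz {V : Type*} [Fintype V] [DecidableEq V]
    (I : Finset V → Finset V → Finset V → Prop) : Prop where
  symmetry : ∀ X Y Z : Finset V,
    Disjoint X Y → Disjoint X Z → Disjoint Y Z → I X Y Z → I Y X Z
  decomposition : ∀ X Y W Z : Finset V,
    Disjoint X Y → Disjoint X W → Disjoint X Z → Disjoint Y W → Disjoint Y Z →
    Disjoint W Z → I X (Y ∪ W) Z → I X Y Z ∧ I X W Z
  transitivity : ∀ (X Y Z : Finset V) (l : V),
    Disjoint X Y → Disjoint X Z → Disjoint Y Z → l ∉ X ∪ Y ∪ Z →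
    I X Y Z → I X {l} Z ∨ I {l} Y Z
  strongUnion : ∀ X Y Z W : Finset V,
    Disjoint X Y → Disjoint X Z → Disjoint X W → Disjoint Y Z → Disjoint Y W →
    Disjoint Z W → I X Y Z → I X Y (Z ∪ W)
  intersection : ∀ X Y W Z : Finset V,
    Disjoint X Y → Disjoint X W → Disjoint X Z → Disjoint Y W → Disjoint Y Z →
    Disjoint W Z → I X Y (Z ∪ W) → I X W (Z ∪ Y) → I X (Y ∪ W) Z

/-- Independence of two single variables is preserved by enlarging the conditioning set. -/
theorem PearlPaz.singleton_mono {V : Type*} [Fintype V] [DecidableEq V]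
    {I : Finset V → Finset V → Finset V → Prop} (hI : PearlPaz I) {a b : V} {S T : Finset V}
    (hab : a ≠ b) (ha : a ∉ T) (hb : b ∉ T) (hST : S ⊆ T) (h : I {a} {b} S) :
    I {a} {b} T := by
  have := hI.strongUnion {a} {b} S (T \ S) (by simpa using hab)
    (by simpa using fun h => ha (hST h)) (by simp [ha])
    (by simpa using fun h => hb (hST h)) (by simp [hb]) Finset.disjoint_sdiff h
  rwa [Finset.union_sdiff_of_subset hST] at this

/-- The D-triangle rule. -/
theorem d_triangle_rule {V : Type*} [Fintype V] [DecidableEq V]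
    {I : Finset V → Finset V → Finset V → Prop} (hI : PearlPaz I)
    (X Y W : V) (hXY : X ≠ Y) (hXW : X ≠ W) (hYW : Y ≠ W)
    (Z₁ Z₂ : Finset V)
    (hZ₁ : ({X, Y, W} : Finset V) ∩ Z₁ = ∅)
    (hZ₂ : ({X, Y, W} : Finset V) ∩ Z₂ = ∅)
    (hdXW : ¬ I {X} {W} Z₁) (hdWY : ¬ I {W} {Y} Z₂) :
    ¬ I {X} {Y} (Z₁ ∩ Z₂) := by
  intro h
  rw [← Finset.disjoint_iff_inter_eq_empty] at hZ₁ hZ₂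
  simp only [Finset.disjoint_insert_left, Finset.disjoint_singleton_left] at hZ₁ hZ₂
  obtain ⟨hX₁, hY₁, hW₁⟩ := hZ₁
  obtain ⟨-, hY₂, hW₂⟩ := hZ₂
  rcases hI.transitivity {X} {Y} (Z₁ ∩ Z₂) W (by simpa using hXY) (by simp [hX₁])
    (by simp [hY₁]) (by simp [hXW.symm, hYW.symm, hW₁]) h with h | h
  · exact hdXW (hI.singleton_mono hXW hX₁ hW₁ Finset.inter_subset_left h)
  · exact hdWY (hI.singleton_mono hYW.symm hW₂ hY₂ Finset.inter_subset_right h)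
end

section
/- I-triangle rule: Let V be a finite set of variables and let I be a ternary relation on pairwise disjoint subsets of V satisfying the Pearl–Paz axioms. Then for all single variables X, Y, W ∈ V (pairwise distinct) and all subsets Z₁, Z₂ ⊆ V with {X,Y,W} ∩ Z₁ = {X,Y,W} ∩ Z₂ = ∅: if I({X},{W},Z₁) and ¬I({W},{Y},Z₁ ∪ Z₂), then I({X},{Y},Z₁). -/
/-- The I-triangle rule. -/
theorem i_triangle_rule {V : Type*} [Fintype V] [DecidableEq V]
    {I : Finset V → Finset V → Finset V → Prop} (hI : PearlPaz I)
    (X Y W : V) (hXY : X ≠ Y) (hXW : X ≠ W) (hYW : Y ≠ W)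
    (Z₁ Z₂ : Finset V)
    (hZ₁ : ({X, Y, W} : Finset V) ∩ Z₁ = ∅)
    (hZ₂ : ({X, Y, W} : Finset V) ∩ Z₂ = ∅)
    (hiXW : I {X} {W} Z₁) (hdWY : ¬ I {W} {Y} (Z₁ ∪ Z₂)) :
    I {X} {Y} Z₁ := by
  have disjoint_of : ∀ {a : V}, a ∈ ({X, Y, W} : Finset V) → ∀ {Z : Finset V},
      ({X, Y, W} : Finset V) ∩ Z = ∅ → Disjoint {a} Z := fun ha _ hZ =>
    (Finset.disjoint_iff_inter_eq_empty.2 hZ).mono_left (Finset.singleton_subset_iff.2 ha)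
  have hX := disjoint_of (a := X) (by simp) hZ₁
  have hY := disjoint_of (a := Y) (by simp) hZ₁
  have hW := disjoint_of (a := W) (by simp) hZ₁
  have hY₂ := (disjoint_of (a := Y) (by simp) hZ₂).mono_right (Finset.sdiff_subset (t := Z₁))
  have hW₂ := (disjoint_of (a := W) (by simp) hZ₂).mono_right (Finset.sdiff_subset (t := Z₁))
  have hYW' : Disjoint ({Y} : Finset V) {W} := Finset.disjoint_singleton.2 hYW
  have hl : Y ∉ ({X} ∪ {W} ∪ Z₁ : Finset V) := by
    simp [hXY.symm, hYW, Finset.disjoint_singleton_left.1 hY]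
  refine (hI.transitivity {X} {W} Z₁ Y (Finset.disjoint_singleton.2 hXW) hX hW hl
    hiXW).resolve_right fun h => hdWY ?_
  rw [← Finset.union_sdiff_self_eq_union]
  exact hI.strongUnion {W} {Y} Z₁ (Z₂ \ Z₁) hYW'.symm hW hW₂ hY hY₂ Finset.disjoint_sdiff
    (hI.symmetry {Y} {W} Z₁ hYW' hY hW h)
end

section
/- Intersection of shields: Let V be a finite set of variables and let I be a ternary relation on pairwise disjoint subsets of V satisfying the Pearl–Paz axioms. For any variable X ∈ V, if S₁ ⊆ V∖{X} and S₂ ⊆ V∖{X} both shield X, then S₁ ∩ S₂ shields X. -/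
/-- A set `S ⊆ V ∖ {X}` *shields* `X` if `I({X}, V ∖ (S ∪ {X}), S)`. -/
def Shields {V : Type*} [Fintype V] [DecidableEq V]
    (I : Finset V → Finset V → Finset V → Prop) (X : V) (S : Finset V) : Prop :=
  X ∉ S ∧ I {X} (Finset.univ \ (S ∪ {X})) S

/-- A *Markov blanket* of `X` is a shield of `X` that is minimal under set
inclusion. -/
def IsMarkovBlanket {V : Type*} [Fintype V] [DecidableEq V]
    (I : Finset V → Finset V → Finset V → Prop) (X : V) (B : Finset V) : Prop :=
  Shields I X B ∧ ∀ S : Finset V, Shields I X S → ¬ S ⊂ B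

/-- Intersection of shields: if `S₁` and `S₂` both shield `X`, then `S₁ ∩ S₂`
shields `X`. -/
theorem shields_inter {V : Type*} [Fintype V] [DecidableEq V]
    {I : Finset V → Finset V → Finset V → Prop} (hI : PearlPaz I)
    (X : V) (S₁ S₂ : Finset V)
    (h₁ : S₁ ⊆ Finset.univ \ {X}) (h₂ : S₂ ⊆ Finset.univ \ {X})
    (hS₁ : Shields I X S₁) (hS₂ : Shields I X S₂) :
    Shields I X (S₁ ∩ S₂) := by
  obtain ⟨hX₁, hI₁⟩ := hS₁
  obtain ⟨hX₂, hI₂⟩ := hS₂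
  refine ⟨fun h => hX₁ (Finset.mem_inter.mp h).1, ?_⟩
  have eq₂ : Finset.univ \ (S₂ ∪ {X}) = (S₁ \ S₂) ∪ (Finset.univ \ (S₁ ∪ S₂ ∪ {X})) := by
    ext a; grind
  have eqS₁ : S₁ = (S₁ ∩ S₂) ∪ (S₁ \ S₂) := by
    ext a; grind
  have eqCompl : S₂ ∪ (Finset.univ \ (S₁ ∪ S₂ ∪ {X})) =
      (S₁ ∩ S₂) ∪ (Finset.univ \ (S₁ ∪ {X})) := by
    ext a; grind
  have eqInter : Finset.univ \ (S₁ ∩ S₂ ∪ {X}) =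
      (Finset.univ \ (S₁ ∪ {X})) ∪ (S₁ \ S₂) := by
    ext a; grind
  rw [eq₂] at hI₂
  have hDiff : I {X} (S₁ \ S₂) S₂ := by
    refine (hI.decomposition _ _ _ _ ?_ ?_ ?_ ?_ ?_ ?_ hI₂).1 <;>
      rw [Finset.disjoint_left] <;> grind
  have hDiff' : I {X} (S₁ \ S₂) ((S₁ ∩ S₂) ∪ (Finset.univ \ (S₁ ∪ {X}))) := by
    rw [← eqCompl]
    refine hI.strongUnion _ _ _ _ ?_ ?_ ?_ ?_ ?_ ?_ hDiff <;>
      rw [Finset.disjoint_left] <;> grind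
  have hRest : I {X} (Finset.univ \ (S₁ ∪ {X})) ((S₁ ∩ S₂) ∪ (S₁ \ S₂)) := by
    rwa [← eqS₁]
  rw [eqInter]
  refine hI.intersection _ _ _ _ ?_ ?_ ?_ ?_ ?_ ?_ hRest hDiff' <;>
    rw [Finset.disjoint_left] <;> grind
end

section
/- Pairwise characterization of the Markov blanket: Let V be a finite set of variables and let I be a ternary relation on pairwise disjoint subsets of V satisfying the Pearl–Paz axioms, and let B(X) denote the (unique) Markov blanket of X. Then for all distinct variables X, Y ∈ V: Y ∈ B(X) if and only if ¬I({X},{Y}, V∖{X,Y}). -/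
/-- Pairwise characterization of the Markov blanket: for distinct `X, Y`,
`Y ∈ B(X)` iff `¬ I({X}, {Y}, V ∖ {X, Y})`. -/
theorem markovBlanket_mem_iff {V : Type*} [Fintype V] [DecidableEq V]
    {I : Finset V → Finset V → Finset V → Prop} (hI : PearlPaz I)
    (X Y : V) (hXY : X ≠ Y) (B : Finset V) (hB : IsMarkovBlanket I X B) :
    Y ∈ B ↔ ¬ I {X} {Y} (Finset.univ \ {X, Y}) := by
  obtain ⟨⟨hXB, hshield⟩, hmin⟩ := hB
  constructor
  · intro hYB hind
    have herase : insert Y (B.erase Y) = B := Finset.insert_erase hYB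
    refine hmin (B.erase Y) ⟨fun h => hXB (Finset.mem_of_mem_erase h), ?_⟩
      (Finset.erase_ssubset hYB)
    have hrest : Finset.univ \ (B.erase Y ∪ {X}) = {Y} ∪ (Finset.univ \ (B ∪ {X})) := by
      ext v; simp only [Finset.mem_sdiff, Finset.mem_univ, Finset.mem_union, Finset.mem_erase,
        Finset.mem_singleton]; grind
    have hcond : Finset.univ \ {X, Y} = B.erase Y ∪ (Finset.univ \ (B ∪ {X})) := by
      ext v; simp only [Finset.mem_sdiff, Finset.mem_univ, Finset.mem_union, Finset.mem_erase,
        Finset.mem_singleton, Finset.mem_insert]; grind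
    have hB' : B.erase Y ∪ {Y} = B := by rw [Finset.union_singleton, herase]
    rw [hrest]
    refine hI.intersection _ _ _ _ ?_ ?_ ?_ ?_ ?_ ?_ (hcond ▸ hind) (hB'.symm ▸ hshield) <;>
      simp only [Finset.disjoint_left] <;> grind
  · intro hdep
    by_contra hYB
    apply hdep
    have hrest : Finset.univ \ (B ∪ {X}) = {Y} ∪ (Finset.univ \ (B ∪ {X, Y})) := by
      ext v; simp only [Finset.mem_sdiff, Finset.mem_univ, Finset.mem_union,
        Finset.mem_singleton, Finset.mem_insert]; grind
    have hcond : Finset.univ \ {X, Y} = B ∪ (Finset.univ \ (B ∪ {X, Y})) := by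
      ext v; simp only [Finset.mem_sdiff, Finset.mem_univ, Finset.mem_union,
        Finset.mem_singleton, Finset.mem_insert]; grind
    rw [hrest] at hshield
    rw [hcond]
    refine hI.strongUnion _ _ _ _ ?_ ?_ ?_ ?_ ?_ ?_
      (hI.decomposition _ _ _ _ ?_ ?_ ?_ ?_ ?_ ?_ hshield).1 <;>
      simp only [Finset.disjoint_left] <;> grind
end

section
/- Symmetry of Markov blanket membership (correctness of the OR-rule under reliable tests): Let V be a finite set of variables and let I be a ternary relation on pairwise disjoint subsets of V satisfying the Pearl–Paz axioms, and let B(X) denote the (unique) Markov blanket of X. Then for all distinct variables X, Y ∈ V: Y ∈ B(X) if and only if X ∈ B(Y). -/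
/-- A variable `Y` lies outside a Markov blanket of `X` exactly when `X` and `Y` are independent
given all remaining variables. -/
theorem IsMarkovBlanket.notMem_iff {V : Type*} [Fintype V] [DecidableEq V]
    {I : Finset V → Finset V → Finset V → Prop} (hI : PearlPaz I)
    {X Y : V} (hXY : X ≠ Y) {B : Finset V} (hB : IsMarkovBlanket I X B) :
    Y ∉ B ↔ I {X} {Y} (Finset.univ \ {X, Y}) := by
  obtain ⟨⟨hX, hS⟩, hmin⟩ := hB
  constructor
  · intro hY
    have hR : Finset.univ \ (B ∪ {X}) = {Y} ∪ (Finset.univ \ (B ∪ {X, Y})) := by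
      grind
    rw [hR] at hS
    have h := (hI.decomposition {X} {Y} (Finset.univ \ (B ∪ {X, Y})) B
      (by simp [hXY]) (by simp) (by simp [hX]) (by simp) (by simp [hY])
      (by grind [Finset.disjoint_left]) hS).1
    have hU : Finset.univ \ {X, Y} = B ∪ (Finset.univ \ (B ∪ {X, Y})) := by
      grind
    rw [hU]
    exact hI.strongUnion {X} {Y} B (Finset.univ \ (B ∪ {X, Y}))
      (by simp [hXY]) (by simp [hX]) (by simp) (by simp [hY]) (by simp)
      (by grind [Finset.disjoint_left]) h
  · intro h hY
    refine hmin (B.erase Y) ⟨by simp [hX], ?_⟩ (Finset.erase_ssubset hY)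
    have hB : B = B.erase Y ∪ {Y} := by grind
    have hU : Finset.univ \ {X, Y} = B.erase Y ∪ (Finset.univ \ (B ∪ {X})) := by
      grind
    have hR : Finset.univ \ (B.erase Y ∪ {X}) = (Finset.univ \ (B ∪ {X})) ∪ {Y} := by
      grind
    rw [hU] at h
    rw [hR]
    refine hI.intersection {X} (Finset.univ \ (B ∪ {X})) {Y} (B.erase Y)
      (by simp) (by simp [hXY]) (by simp [hX]) (by simp [hY])
      (by grind [Finset.disjoint_left]) (by simp) ?_ h
    rwa [← hB]

/-- Symmetry of Markov blanket membership: for distinct `X, Y`,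
`Y ∈ B(X)` iff `X ∈ B(Y)`. -/
theorem markovBlanket_symm {V : Type*} [Fintype V] [DecidableEq V]
    {I : Finset V → Finset V → Finset V → Prop} (hI : PearlPaz I)
    (X Y : V) (hXY : X ≠ Y) (BX BY : Finset V)
    (hBX : IsMarkovBlanket I X BX) (hBY : IsMarkovBlanket I Y BY) :
    Y ∈ BX ↔ X ∈ BY := by
  have hcomm : I {X} {Y} (Finset.univ \ {X, Y}) ↔ I {Y} {X} (Finset.univ \ {Y, X}) := by
    rw [Finset.pair_comm Y X]
    exact ⟨hI.symmetry _ _ _ (by simp [hXY]) (by simp) (by simp),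
      hI.symmetry _ _ _ (by simp [hXY.symm]) (by simp) (by simp)⟩
  rw [← not_iff_not, hBX.notMem_iff hI hXY, hBY.notMem_iff hI hXY.symm, hcomm]
end

section
/- Soundness of the shrink phase of the GS algorithm: Let V be a finite set of variables and let I be a ternary relation on pairwise disjoint subsets of V satisfying the Pearl–Paz axioms, and let B(X) denote the (unique) Markov blanket of a variable X. For any set S with B(X) ⊆ S ⊆ V∖{X} and any Y ∈ S: Y ∉ B(X) if and only if I({X},{Y}, S∖{Y}). -/
/-- Soundness of the shrink phase of GS: for any `S` with `B(X) ⊆ S ⊆ V ∖ {X}`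
and any `Y ∈ S`: `Y ∉ B(X)` iff `I({X}, {Y}, S ∖ {Y})`. -/
theorem shrink_phase_sound {V : Type*} [Fintype V] [DecidableEq V]
    {I : Finset V → Finset V → Finset V → Prop} (hI : PearlPaz I)
    (X : V) (B S : Finset V) (hB : IsMarkovBlanket I X B)
    (hBS : B ⊆ S) (hS : S ⊆ Finset.univ \ {X}) (Y : V) (hY : Y ∈ S) :
    Y ∉ B ↔ I {X} {Y} (S \ {Y}) := by
  obtain ⟨⟨hXB, hIB⟩, hmin⟩ := hB
  have hXS : X ∉ S := fun h => by simpa using hS h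
  have hXY : X ≠ Y := fun h => hXS (h ▸ hY)
  constructor
  · intro hYB
    have hsplit : Finset.univ \ (B ∪ {X}) = {Y} ∪ (Finset.univ \ (B ∪ {X, Y})) := by
      ext a; simp; grind
    rw [hsplit] at hIB
    have hIY := (hI.decomposition {X} {Y} _ B (by simpa) (by simp) (by simpa) (by simp)
      (by simpa) (by rw [Finset.disjoint_left]; grind) hIB).1
    have hcond : S \ {Y} = B ∪ ((S \ {Y}) \ B) := by
      ext a; grind
    rw [hcond]
    exact hI.strongUnion {X} {Y} B _ (by simpa) (by simpa) (by simp [hXS]) (by simpa) (by simp)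
      Finset.disjoint_sdiff hIY
  · intro hIY hYB
    have hIY' : I {X} {Y} (B.erase Y ∪ (Finset.univ \ (B ∪ {X}))) := by
      have hcond : B.erase Y ∪ (Finset.univ \ (B ∪ {X})) =
          (S \ {Y}) ∪ (Finset.univ \ (S ∪ {X})) := by
        ext a; simp; grind
      rw [hcond]
      exact hI.strongUnion {X} {Y} _ _ (by simpa) (by simp [hXS]) (by simp) (by simp)
        (by simp [hY]) (by rw [Finset.disjoint_left]; grind) hIY
    have hIR : I {X} (Finset.univ \ (B ∪ {X})) (B.erase Y ∪ {Y}) := by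
      have hcond : B.erase Y ∪ {Y} = B := by ext a; grind
      rwa [hcond]
    have hI' := hI.intersection {X} {Y} _ (B.erase Y) (by simpa) (by simp) (by simp [hXB])
      (by simp [hYB]) (by simp) (by rw [Finset.disjoint_left]; grind) hIY' hIR
    have hcompl : {Y} ∪ (Finset.univ \ (B ∪ {X})) = Finset.univ \ (B.erase Y ∪ {X}) := by
      ext a; simp; grind
    rw [hcompl] at hI'
    exact hmin (B.erase Y) ⟨by simp [hXB], hI'⟩ (Finset.erase_ssubset hYB)
end

section
/- Vertex separation satisfies Intersection: Let G be a simple graph on a finite vertex set V and let X, Y, Z, W ⊆ V be pairwise disjoint. If Z ∪ W separates X from Y in G and Z ∪ Y separates X from W in G, then Z separates X from Y ∪ W in G. -/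
/-- `Z` *separates* `X` from `Y` in the simple graph `G` if every walk in `G`
from a vertex of `X` to a vertex of `Y` contains a vertex of `Z`. -/
def Separates {V : Type*} [Fintype V] [DecidableEq V] (G : SimpleGraph V)
    (X Y Z : Finset V) : Prop :=
  ∀ ⦃a b : V⦄, a ∈ X → b ∈ Y → ∀ w : G.Walk a b, ∃ v ∈ w.support, v ∈ Z

/-- Vertex separation satisfies Intersection. -/
theorem separates_intersection {V : Type*} [Fintype V] [DecidableEq V]
    (G : SimpleGraph V) (X Y Z W : Finset V)
    (hXY : Disjoint X Y) (hXZ : Disjoint X Z) (hXW : Disjoint X W)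
    (hYZ : Disjoint Y Z) (hYW : Disjoint Y W) (hZW : Disjoint Z W)
    (h1 : Separates G X Y (Z ∪ W)) (h2 : Separates G X W (Z ∪ Y)) :
    Separates G X (Y ∪ W) Z := by
  suffices h : ∀ (n : ℕ) ⦃a b : V⦄ (w : G.Walk a b), w.length = n → a ∈ X → b ∈ Y ∪ W →
      ∃ v ∈ w.support, v ∈ Z from fun a b ha hb w ↦ h _ w rfl ha hb
  intro n
  induction n using Nat.strong_induction_on with
  | _ n ih =>
    intro a b w hn ha hb
    by_contra! hZ
    -- a vertex of `Y ∪ W` other than the endpoint would give a shorter walk avoiding `Z`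
    have key : ∀ v ∈ w.support, v ∈ Y ∪ W → v = b := by
      intro v hv hvYW
      by_contra hne
      obtain ⟨u, hu, huZ⟩ :=
        ih _ (hn ▸ w.length_takeUntil_lt_length hv hne) (w.takeUntil v hv) rfl ha hvYW
      exact hZ u (w.support_takeUntil_subset_support hv hu) huZ
    rcases Finset.mem_union.1 hb with hbY | hbW
    · obtain ⟨v, hv, hvZW⟩ := h1 ha hbY w
      have hvW : v ∈ W := (Finset.mem_union.1 hvZW).resolve_left (hZ v hv)
      exact Finset.disjoint_left.1 hYW hbY (key v hv (Finset.mem_union_right _ hvW) ▸ hvW)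
    · obtain ⟨v, hv, hvZY⟩ := h2 ha hbW w
      have hvY : v ∈ Y := (Finset.mem_union.1 hvZY).resolve_left (hZ v hv)
      exact Finset.disjoint_left.1 hYW (key v hv (Finset.mem_union_left _ hvY) ▸ hvY) hbW
end

section
/- Pearl–Paz graph-isomorphism theorem (sufficiency): Let V be a finite set of variables and let I be a ternary relation on pairwise disjoint subsets of V satisfying the Pearl–Paz axioms. Define a simple graph G on V by joining distinct vertices X and Y by an edge if and only if ¬I({X},{Y}, V∖{X,Y}). Then G is a perfect map of I: for all pairwise disjoint subsets X, Y, Z ⊆ V with X and Y nonempty, Z separates X from Y in G if and only if I(X,Y,Z). -/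
namespace PearlPaz

variable {V : Type*} [Fintype V] [DecidableEq V] {I : Finset V → Finset V → Finset V → Prop}

lemma mono_left (hI : PearlPaz I) {X X' Y Z : Finset V} (hX : X' ⊆ X) (hXY : Disjoint X Y)
    (hXZ : Disjoint X Z) (hYZ : Disjoint Y Z) (h : I X Y Z) : I X' Y Z := by
  have hs := hI.symmetry X Y Z hXY hXZ hYZ h
  rw [← Finset.union_sdiff_of_subset hX] at hs
  have hd := hI.decomposition Y X' (X \ X') Z (hXY.symm.mono_right hX)
    (hXY.symm.mono_right Finset.sdiff_subset) hYZ Finset.disjoint_sdiff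
    (hXZ.mono_left hX) (hXZ.mono_left Finset.sdiff_subset) hs
  exact hI.symmetry Y X' Z (hXY.symm.mono_right hX) hYZ (hXZ.mono_left hX) hd.1

lemma mono_right (hI : PearlPaz I) {X Y Y' Z : Finset V} (hY : Y' ⊆ Y) (hXY : Disjoint X Y)
    (hXZ : Disjoint X Z) (hYZ : Disjoint Y Z) (h : I X Y Z) : I X Y' Z :=
  hI.symmetry _ _ _ (hXY.symm.mono_left hY) (hYZ.mono_left hY) hXZ
    (hI.mono_left hY hXY.symm hYZ hXZ (hI.symmetry _ _ _ hXY hXZ hYZ h))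

lemma mono_cond (hI : PearlPaz I) {X Y Z Z' : Finset V} (hZ : Z ⊆ Z') (hXY : Disjoint X Y)
    (hXZ : Disjoint X Z') (hYZ : Disjoint Y Z') (h : I X Y Z) : I X Y Z' := by
  rw [← Finset.union_sdiff_of_subset hZ]
  exact hI.strongUnion X Y Z (Z' \ Z) hXY (hXZ.mono_right hZ)
    (hXZ.mono_right Finset.sdiff_subset) (hYZ.mono_right hZ)
    (hYZ.mono_right Finset.sdiff_subset) Finset.disjoint_sdiff h

lemma composition (hI : PearlPaz I) {X Y W Z : Finset V} (hXY : Disjoint X Y)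
    (hXW : Disjoint X W) (hXZ : Disjoint X Z) (hYW : Disjoint Y W) (hYZ : Disjoint Y Z)
    (hWZ : Disjoint W Z) (hY : I X Y Z) (hW : I X W Z) : I X (Y ∪ W) Z :=
  hI.intersection X Y W Z hXY hXW hXZ hYW hYZ hWZ
    (hI.strongUnion X Y Z W hXY hXZ hXW hYZ hYW hWZ.symm hY)
    (hI.strongUnion X W Z Y hXW hXZ hXY hWZ hYW.symm hYZ.symm hW)

lemma of_forall_right (hI : PearlPaz I) {X Y Z : Finset V} (hXY : Disjoint X Y)
    (hXZ : Disjoint X Z) (hYZ : Disjoint Y Z) (hY : Y.Nonempty)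
    (h : ∀ b ∈ Y, I X {b} Z) : I X Y Z := by
  induction hY using Finset.Nonempty.cons_induction with
  | singleton b => exact h b (Finset.mem_singleton_self b)
  | cons b Y hb _ ih =>
    rw [Finset.cons_eq_insert, Finset.insert_eq] at *
    rw [Finset.disjoint_union_right] at hXY
    rw [Finset.disjoint_union_left] at hYZ
    exact hI.composition hXY.1 hXY.2 hXZ (Finset.disjoint_singleton_left.2 hb) hYZ.1 hYZ.2
      (h b (by simp)) (ih hXY.2 hYZ.2 fun c hc => h c (by simp [hc]))

lemma of_forall (hI : PearlPaz I) {X Y Z : Finset V} (hXY : Disjoint X Y)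
    (hXZ : Disjoint X Z) (hYZ : Disjoint Y Z) (hX : X.Nonempty) (hY : Y.Nonempty)
    (h : ∀ a ∈ X, ∀ b ∈ Y, I {a} {b} Z) : I X Y Z := by
  refine hI.symmetry Y X Z hXY.symm hYZ hXZ
    (hI.of_forall_right hXY.symm hYZ hXZ hX fun a ha => ?_)
  have haY : Disjoint {a} Y := hXY.mono_left (Finset.singleton_subset_iff.2 ha)
  have haZ : Disjoint {a} Z := hXZ.mono_left (Finset.singleton_subset_iff.2 ha)
  exact hI.symmetry _ _ _ haY haZ hYZ (hI.of_forall_right haY haZ hYZ hY (h a ha))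

lemma not_indep_of_walk (hI : PearlPaz I) {G : SimpleGraph V}
    (hG : ∀ x y : V, G.Adj x y → ¬ I {x} {y} (Finset.univ \ {x, y})) {Z : Finset V}
    {a b : V} (w : G.Walk a b) (hw : ∀ v ∈ w.support, v ∉ Z) (hab : a ≠ b) :
    ¬ I {a} {b} Z := by
  have not_indep_of_adj {x y : V} (h : G.Adj x y) (hx : x ∉ Z) (hy : y ∉ Z) :
      ¬ I {x} {y} Z := fun hxy =>
    hG x y h <| hI.mono_cond (fun v hv => by
      simp only [Finset.mem_sdiff, Finset.mem_univ, Finset.mem_insert, Finset.mem_singleton]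
      grind) (by simpa using h.ne) (by simp) (by simp) hxy
  induction w with
  | nil => exact absurd rfl hab
  | @cons a c b h p ih =>
    have ha : a ∉ Z := hw a (by simp)
    have hc : c ∉ Z := hw c (by simp)
    have hb : b ∉ Z := hw b (by simp)
    by_cases hcb : c = b
    · subst hcb
      exact not_indep_of_adj h ha hc
    · intro hIab
      rcases hI.transitivity {a} {b} Z c (by simpa using hab) (by simpa using ha)
        (by simpa using hb) (by simp [hc, hcb, h.ne']) hIab with h1 | h1
      · exact not_indep_of_adj h ha hc h1
      · exact ih (fun v hv => hw v (by simp [hv])) hcb h1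

end PearlPaz

section Separates

variable {V : Type*} [Fintype V] [DecidableEq V] {G : SimpleGraph V}

lemma Separates.mono {X X' Y Y' Z Z' : Finset V} (hX : X' ⊆ X) (hY : Y' ⊆ Y) (hZ : Z ⊆ Z')
    (h : Separates G X Y Z) : Separates G X' Y' Z' := fun _ _ ha hb w =>
  (h (hX ha) (hY hb) w).imp fun _ hv => ⟨hv.1, hZ hv.2⟩

lemma Separates.symm {X Y Z : Finset V} (h : Separates G X Y Z) : Separates G Y X Z :=
  fun a b ha hb w => by simpa using h hb ha w.reverse

lemma Separates.singleton_or {a b : V} {Z : Finset V} (h : Separates G {a} {b} Z) (c : V) :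
    Separates G {a} {c} Z ∨ Separates G {c} {b} Z := by
  simp only [Separates, Finset.mem_singleton] at h ⊢
  by_contra! hc
  obtain ⟨⟨_, _, rfl, rfl, w₁, h₁⟩, ⟨_, _, rfl, rfl, w₂, h₂⟩⟩ := hc
  obtain ⟨v, hv, hvZ⟩ := h rfl rfl (w₁.append w₂)
  rcases (SimpleGraph.Walk.mem_support_append_iff w₁ w₂).1 hv with hv | hv
  · exact h₁ v hv hvZ
  · exact h₂ v hv hvZ

end Separates

lemma PearlPaz.indep_of_separates_singleton {V : Type*} [Fintype V] [DecidableEq V]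
    {I : Finset V → Finset V → Finset V → Prop} (hI : PearlPaz I) {G : SimpleGraph V}
    (hG : ∀ x y : V, x ≠ y → ¬ G.Adj x y → I {x} {y} (Finset.univ \ {x, y}))
    (Z : Finset V) : ∀ {a b : V}, a ≠ b → a ∉ Z → b ∉ Z → Separates G {a} {b} Z →
      I {a} {b} Z := by
  induction Z using WellFoundedGT.induction with | _ Z ih
  intro a b hab ha hb hs
  have grow {c d x : V} (hcd : c ≠ d) (hc : c ∉ Z) (hd : d ∉ Z) (hx : x ∉ Z)
      (hxc : x ≠ c) (hxd : x ≠ d) (h : Separates G {c} {d} Z) : I {c} {d} (Z ∪ {x}) := by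
    refine ih _ ?_ hcd (by simp [hc, hxc.symm])
      (by simp [hd, hxd.symm])
      (h.mono subset_rfl subset_rfl Finset.subset_union_left)
    exact Finset.ssubset_iff_subset_ne.2 ⟨Finset.subset_union_left, by grind⟩
  have step {a b c : V} (hab : a ≠ b) (ha : a ∉ Z) (hb : b ∉ Z) (hc : c ∉ Z) (hca : c ≠ a)
      (hcb : c ≠ b) (hs : Separates G {a} {b} Z) (hac : Separates G {a} {c} Z) :
      I {a} {b} Z := by
    have h := hI.intersection {a} {b} {c} Z (by simpa using hab) (by simpa using hca.symm)
      (by simpa using ha) (by simpa using hcb.symm) (by simpa using hb) (by simpa using hc)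
      (grow hab ha hb hc hca hcb hs) (grow hca.symm ha hc hb hab.symm hcb.symm hac)
    exact hI.mono_right Finset.subset_union_left (by simp [hab, hca.symm]) (by simpa using ha)
      (by simp [hb, hc]) h
  by_cases hZ : ∃ c, c ∉ Z ∧ c ≠ a ∧ c ≠ b
  · obtain ⟨c, hc, hca, hcb⟩ := hZ
    rcases hs.singleton_or c with h | h
    · exact step hab ha hb hc hca hcb hs h
    · exact hI.symmetry _ _ _ (by simpa using hab.symm) (by simpa using hb)
        (by simpa using ha) (step hab.symm hb ha hc hcb hca hs.symm h.symm)
  · have hZ' : Z = Finset.univ \ {a, b} := by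
      ext v
      simp only [Finset.mem_sdiff, Finset.mem_univ, Finset.mem_insert, Finset.mem_singleton]
      grind
    rw [hZ']
    refine hG a b hab fun hadj => ?_
    obtain ⟨v, hv, hvZ⟩ := hs (by simp) (by simp) hadj.toWalk
    simp only [SimpleGraph.Adj.toWalk, SimpleGraph.Walk.support_cons,
      SimpleGraph.Walk.support_nil, List.mem_cons, List.not_mem_nil, or_false] at hv
    grind

/-- Pearl–Paz graph-isomorphism theorem (sufficiency): the graph joining
distinct `X, Y` by an edge iff `¬ I({X},{Y}, V ∖ {X,Y})` is a perfect map
of `I`. -/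
theorem pearl_paz_perfect_map {V : Type*} [Fintype V] [DecidableEq V]
    {I : Finset V → Finset V → Finset V → Prop} (hI : PearlPaz I)
    (G : SimpleGraph V)
    (hG : ∀ X Y : V, G.Adj X Y ↔
      X ≠ Y ∧ ¬ I {X} {Y} (Finset.univ \ {X, Y})) :
    ∀ X Y Z : Finset V, Disjoint X Y → Disjoint X Z → Disjoint Y Z →
      X.Nonempty → Y.Nonempty → (Separates G X Y Z ↔ I X Y Z) := by
  intro X Y Z hXY hXZ hYZ hX hY
  have hne {a b : V} (ha : a ∈ X) (hb : b ∈ Y) : a ≠ b :=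
    fun h => Finset.disjoint_left.1 hXY ha (h ▸ hb)
  constructor
  · intro hs
    refine hI.of_forall hXY hXZ hYZ hX hY fun a ha b hb => ?_
    refine hI.indep_of_separates_singleton (G := G) (fun x y hxy hadj => ?_) Z (hne ha hb)
      (Finset.disjoint_left.1 hXZ ha) (Finset.disjoint_left.1 hYZ hb)
      (hs.mono (by simpa using ha) (by simpa using hb) subset_rfl)
    by_contra hn
    exact hadj ((hG x y).2 ⟨hxy, hn⟩)
  · intro h a b ha hb w
    by_contra! hw
    have ha' : {a} ⊆ X := Finset.singleton_subset_iff.2 ha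
    exact hI.not_indep_of_walk (fun x y hxy => ((hG x y).1 hxy).2) w hw (hne ha hb)
      (hI.mono_right (Finset.singleton_subset_iff.2 hb) (hXY.mono_left ha')
        (hXZ.mono_left ha') hYZ (hI.mono_left ha' hXY hXZ hYZ h))
end

section
/- Intersection axiom for strictly positive discrete distributions: Let V be a finite index set, let α_v be a finite nonempty type for each v ∈ V, and let μ be a probability measure on the product Π_{v∈V} α_v that is strictly positive (every single point has positive probability). For all pairwise disjoint subsets A, B, W, C ⊆ V: if CI_μ(A, B, C ∪ W) and CI_μ(A, W, C ∪ B), then CI_μ(A, B ∪ W, C). -/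
open scoped ENNReal

/-- The probability, under the distribution `μ`, of the event that a random
assignment agrees with `x` on all the coordinates in `S`. -/
noncomputable def prMatch {V : Type*} [Fintype V] [DecidableEq V]
    {α : V → Type*} [∀ v, Fintype (α v)] [∀ v, DecidableEq (α v)]
    (μ : PMF (∀ v, α v)) (S : Finset V) (x : ∀ v, α v) : ℝ≥0∞ :=
  ∑ f ∈ Finset.univ.filter (fun f : ∀ v, α v => ∀ v ∈ S, f v = x v), μ f

/-- `A` is conditionally independent of `B` given `C` under `μ`:
for every assignment `x`,
`μ{f agrees with x on A∪B∪C} ⬝ μ{f agrees with x on C}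
  = μ{f agrees with x on A∪C} ⬝ μ{f agrees with x on B∪C}`. -/
def CondIndep {V : Type*} [Fintype V] [DecidableEq V]
    {α : V → Type*} [∀ v, Fintype (α v)] [∀ v, DecidableEq (α v)]
    (μ : PMF (∀ v, α v)) (A B C : Finset V) : Prop :=
  ∀ x : ∀ v, α v,
    prMatch μ (A ∪ B ∪ C) x * prMatch μ C x
      = prMatch μ (A ∪ C) x * prMatch μ (B ∪ C) x

section prMatch

variable {V : Type*} [Fintype V] [DecidableEq V]
  {α : V → Type*} [∀ v, Fintype (α v)] [∀ v, DecidableEq (α v)] (μ : PMF (∀ v, α v))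

lemma prMatch_ne_top (S : Finset V) (x : ∀ v, α v) : prMatch μ S x ≠ ⊤ :=
  ENNReal.sum_ne_top.2 fun f _ => μ.apply_ne_top f

lemma prMatch_ne_zero (hpos : ∀ f : ∀ v, α v, 0 < μ f) (S : Finset V) (x : ∀ v, α v) :
    prMatch μ S x ≠ 0 := by
  intro h
  exact (hpos x).ne' (Finset.sum_eq_zero_iff.1 h x (by simp))

lemma prMatch_congr {S : Finset V} {x y : ∀ v, α v} (h : ∀ v ∈ S, x v = y v) :
    prMatch μ S x = prMatch μ S y := by
  unfold prMatch
  congr 1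
  ext f
  simp +contextual [h]

/-- Marginalization: summing over all the ways to modify `x` on `B` removes the
constraint on `B`. -/
lemma sum_prMatch_union {S B : Finset V} (hSB : Disjoint S B) (x : ∀ v, α v) :
    ∑ y ∈ Finset.univ.filter (fun y : ∀ v, α v => ∀ v ∉ B, y v = x v), prMatch μ (S ∪ B) y
      = prMatch μ S x := by
  unfold prMatch
  conv_rhs => rw [← Finset.sum_fiberwise_of_maps_to (g := fun f => B.piecewise f x)
    (t := Finset.univ.filter (fun y : ∀ v, α v => ∀ v ∉ B, y v = x v))
    (by simp +contextual [Finset.piecewise])]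
  refine Finset.sum_congr rfl fun y hy => ?_
  congr 1
  ext f
  simp only [Finset.mem_filter, Finset.mem_univ, true_and, Finset.mem_union] at hy ⊢
  constructor
  · intro h
    refine ⟨fun v hv => ?_, funext fun v => ?_⟩
    · rw [h v (Or.inl hv), hy v (Finset.disjoint_left.1 hSB hv)]
    · by_cases hv : v ∈ B
      · simp [hv, h v (Or.inr hv)]
      · simp [hv, hy v hv]
  · rintro ⟨h, rfl⟩ v hv
    by_cases hvB : v ∈ B
    · simp [hvB]
    · simpa [hvB] using h v (hv.resolve_right hvB)

end prMatch

/-- Intersection axiom for strictly positive discrete distributions. -/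
theorem condIndep_intersection {V : Type*} [Fintype V] [DecidableEq V]
    {α : V → Type*} [∀ v, Fintype (α v)] [∀ v, DecidableEq (α v)]
    [∀ v, Nonempty (α v)]
    (μ : PMF (∀ v, α v)) (hpos : ∀ f : ∀ v, α v, 0 < μ f)
    (A B W C : Finset V)
    (hAB : Disjoint A B) (hAW : Disjoint A W) (hAC : Disjoint A C)
    (hBW : Disjoint B W) (hBC : Disjoint B C) (hWC : Disjoint W C)
    (h1 : CondIndep μ A B (C ∪ W)) (h2 : CondIndep μ A W (C ∪ B)) :
    CondIndep μ A (B ∪ W) C := by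
  have key (y : ∀ v, α v) :
      prMatch μ (A ∪ C ∪ W) y * prMatch μ (C ∪ B) y
        = prMatch μ (A ∪ C ∪ B) y * prMatch μ (C ∪ W) y := by
    have e1 := h1 y
    have e2 := h2 y
    rw [show A ∪ B ∪ (C ∪ W) = A ∪ B ∪ W ∪ C by ac_rfl, ← Finset.union_assoc A,
      show B ∪ (C ∪ W) = B ∪ W ∪ C by ac_rfl] at e1
    rw [show A ∪ W ∪ (C ∪ B) = A ∪ B ∪ W ∪ C by ac_rfl, ← Finset.union_assoc A,
      show W ∪ (C ∪ B) = B ∪ W ∪ C by ac_rfl] at e2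
    refine (ENNReal.mul_left_inj (prMatch_ne_zero μ hpos (B ∪ W ∪ C) y)
      (prMatch_ne_top μ _ y)).1 ?_
    rw [mul_right_comm, ← e1, mul_right_comm, e2, mul_right_comm]
  intro x
  have hmarg : prMatch μ (A ∪ C ∪ W) x * prMatch μ C x
      = prMatch μ (A ∪ C) x * prMatch μ (C ∪ W) x := by
    rw [← sum_prMatch_union μ hBC.symm x,
      ← sum_prMatch_union μ (Finset.disjoint_union_left.2 ⟨hAB, hBC.symm⟩) x,
      Finset.mul_sum, Finset.sum_mul]
    refine Finset.sum_congr rfl fun y hy => ?_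
    have hyx : ∀ v ∉ B, y v = x v := by simpa using hy
    have hACW : Disjoint (A ∪ C ∪ W) B := by
      simp only [Finset.disjoint_union_left]
      exact ⟨⟨hAB, hBC.symm⟩, hBW.symm⟩
    have hCW : Disjoint (C ∪ W) B := Finset.disjoint_union_left.2 ⟨hBC.symm, hBW.symm⟩
    rw [← prMatch_congr μ fun v hv => hyx v (Finset.disjoint_left.1 hACW hv),
      ← prMatch_congr μ fun v hv => hyx v (Finset.disjoint_left.1 hCW hv), key]
  have e1 := h1 x
  rw [show A ∪ B ∪ (C ∪ W) = A ∪ (B ∪ W) ∪ C by ac_rfl, ← Finset.union_assoc A C,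
    show B ∪ (C ∪ W) = B ∪ W ∪ C by ac_rfl] at e1
  refine (ENNReal.mul_left_inj (prMatch_ne_zero μ hpos (C ∪ W) x)
    (prMatch_ne_top μ _ x)).1 ?_
  rw [mul_right_comm, e1, mul_right_comm, hmarg, mul_right_comm]
end

section
/- Gibbs factorization implies the global Markov property: Let V be a finite index set, let α_v be a finite nonempty type for each v ∈ V, let G be a simple graph on V, and let μ be a probability measure on Π_{v∈V} α_v whose probability mass function factorizes over the cliques of G, i.e. there is a finite family (c_j)_{j∈J} of cliques of G and nonnegative functions g_j depending only on the coordinates in c_j such that μ{f} = ∏_{j∈J} g_j(f restricted to c_j) for every f. Then for all pairwise disjoint A, B, S ⊆ V: if S separates A from B in G, then CI_μ(A, B, S). -/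
open scoped ENNReal

/-- A separator cuts off a vertex set `U` containing `A`, disjoint from `B`, and closed under
adjacency outside the separator. -/
theorem Separates.exists_side {V : Type*} [Fintype V] [DecidableEq V] {G : SimpleGraph V}
    {A B S : Finset V} (hAS : Disjoint A S) (h : Separates G A B S) :
    ∃ U : Finset V, A ⊆ U ∧ Disjoint B U ∧
      ∀ u ∈ U, ∀ v, G.Adj u v → v ∉ S → v ∈ U := by
  classical
  refine ⟨Finset.univ.filter fun v => ∃ a ∈ A, ∃ w : G.Walk a v, ∀ u ∈ w.support, u ∉ S,
    fun a ha => ?_, ?_, ?_⟩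
  · simp only [Finset.mem_filter_univ]
    refine ⟨a, ha, .nil, fun u hu => ?_⟩
    rw [SimpleGraph.Walk.support_nil, List.mem_singleton] at hu
    exact hu ▸ Finset.disjoint_left.mp hAS ha
  · refine Finset.disjoint_left.mpr fun b hb hbU => ?_
    obtain ⟨a, ha, w, hw⟩ := (Finset.mem_filter_univ b).mp hbU
    obtain ⟨v, hv, hvS⟩ := h ha hb w
    exact hw v hv hvS
  · intro u hu v huv hv
    simp only [Finset.mem_filter_univ] at hu ⊢
    obtain ⟨a, ha, w, hw⟩ := hu
    refine ⟨a, ha, w.concat huv, fun z hz => ?_⟩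
    rw [SimpleGraph.Walk.support_concat, List.mem_append, List.mem_singleton] at hz
    rcases hz with hz | rfl
    exacts [hw z hz, hv]

/-- If swapping the `U`-coordinates of two assignments that agree on `S` preserves the product of
their probabilities, then subsets of `U` and of its complement are independent given `S`. -/
theorem condIndep_of_exchange {V : Type*} [Fintype V] [DecidableEq V]
    {α : V → Type*} [∀ v, Fintype (α v)] [∀ v, DecidableEq (α v)] {μ : PMF (∀ v, α v)}
    {A B S U : Finset V} (hA : A ⊆ U) (hB : Disjoint B U)
    (hex : ∀ f h : ∀ v, α v, (∀ v ∈ S, f v = h v) →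
      μ f * μ h = μ (U.piecewise f h) * μ (U.piecewise h f)) :
    CondIndep μ A B S := by
  intro x
  have hB' : ∀ v ∈ B, v ∉ U := fun v hv => Finset.disjoint_left.mp hB hv
  unfold prMatch
  rw [Finset.sum_mul_sum, Finset.sum_mul_sum, ← Finset.sum_product', ← Finset.sum_product']
  refine Finset.sum_nbij' (fun p => (U.piecewise p.1 p.2, U.piecewise p.2 p.1))
    (fun p => (U.piecewise p.1 p.2, U.piecewise p.2 p.1)) ?_ ?_ ?_ ?_ ?_
  · rintro ⟨f, h⟩ hp
    simp only [Finset.mem_product, Finset.mem_filter_univ, Finset.mem_union,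
      Finset.piecewise] at hp ⊢
    grind
  · rintro ⟨f, h⟩ hp
    simp only [Finset.mem_product, Finset.mem_filter_univ, Finset.mem_union,
      Finset.piecewise] at hp ⊢
    grind
  · rintro ⟨f, h⟩ -
    simp [Finset.piecewise_same]
  · rintro ⟨f, h⟩ -
    simp [Finset.piecewise_same]
  · rintro ⟨f, h⟩ hp
    simp only [Finset.mem_product, Finset.mem_filter_univ, Finset.mem_union] at hp
    exact hex f h fun v hv => (hp.1 v (.inr hv)).trans (hp.2 v hv).symm

/-- A function of the coordinates in a clique is compatible with swapping the coordinates on a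
set `U` closed under adjacency outside `S`. -/
theorem mul_eq_mul_piecewise_of_isClique {V : Type*} [DecidableEq V] {α : V → Type*}
    {M : Type*} [CommMagma M] {G : SimpleGraph V} {S U c : Finset V}
    (hc : G.IsClique (c : Set V)) (hU : ∀ u ∈ U, ∀ v, G.Adj u v → v ∉ S → v ∈ U)
    {g : (∀ v, α v) → M} (hg : ∀ f f' : ∀ v, α v, (∀ v ∈ c, f v = f' v) → g f = g f')
    {f h : ∀ v, α v} (hfh : ∀ v ∈ S, f v = h v) :
    g f * g h = g (U.piecewise f h) * g (U.piecewise h f) := by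
  by_cases hcU : ∃ u ∈ c, u ∈ U
  · obtain ⟨u, huc, huU⟩ := hcU
    have hmem : ∀ v ∈ c, v ∉ U → v ∈ S := fun v hv hvU => by
      by_contra hvS
      exact hvU (hU u huU v (hc huc hv fun huv => hvU (huv ▸ huU)) hvS)
    congr 1 <;> refine hg _ _ fun v hv => ?_ <;> by_cases hvU : v ∈ U
    · simp [hvU]
    · simp [hvU, hfh v (hmem v hv hvU)]
    · simp [hvU]
    · simp [hvU, hfh v (hmem v hv hvU)]
  · push Not at hcU
    rw [mul_comm]
    congr 1 <;> exact hg _ _ fun v hv => by simp [hcU v hv]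

/-- Gibbs factorization implies the global Markov property: if the probability
mass function of `μ` factorizes as a product of (nonnegative) functions, each
depending only on the coordinates of a clique of `G`, then whenever `S`
separates `A` from `B` in `G`, `A` is conditionally independent of `B`
given `S` under `μ`. -/
theorem gibbs_factorization_global_markov {V : Type*} [Fintype V] [DecidableEq V]
    {α : V → Type*} [∀ v, Fintype (α v)] [∀ v, DecidableEq (α v)]
    [∀ v, Nonempty (α v)]
    (G : SimpleGraph V) (μ : PMF (∀ v, α v))
    {ι : Type*} (J : Finset ι) (c : ι → Finset V) (g : ι → (∀ v, α v) → ℝ≥0∞)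
    (hclique : ∀ j ∈ J, G.IsClique (c j : Set V))
    (hlocal : ∀ j ∈ J, ∀ f f' : ∀ v, α v,
      (∀ v ∈ c j, f v = f' v) → g j f = g j f')
    (hfact : ∀ f : ∀ v, α v, μ f = ∏ j ∈ J, g j f) :
    ∀ A B S : Finset V, Disjoint A B → Disjoint A S → Disjoint B S →
      Separates G A B S → CondIndep μ A B S := by
  intro A B S _ hAS _ hsep
  obtain ⟨U, hAU, hBU, hU⟩ := hsep.exists_side hAS
  refine condIndep_of_exchange hAU hBU fun f h hfh => ?_
  simp only [hfact, ← Finset.prod_mul_distrib]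
  exact Finset.prod_congr rfl fun j hj =>
    mul_eq_mul_piecewise_of_isClique (hclique j hj) hU (hlocal j hj) hfh
end
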